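/- Let 0 < ε < 1 and let g : ℝ → ℝ → ℝ be such that g(0, θ) = θ for all θ, for each θ the map s ↦ g(s, θ) is infinitely differentiable on (−ε, ε), and f(s, g(s, θ)) = θ for all θ ∈ ℝ and all s with |s| < ε, where f(s, φ) = (π/2) · (∫₀^φ (1 − s·sin²τ)^(−1/2) dτ) / (∫₀^{π/2} (1 − s·sin²τ)^(−1/2) dτ). Then for all integers j ≥ 1 and k ≥ 1, (1/(2π · j!)) · [ ∫_{−π}^{π} (∂_s^j [cos(k · g(s, θ))])(0, θ) · cos((k − 2j)θ) dθ + ∫_{−π}^{π} (∂_s^j [sin(k · g(s, θ))])(0, θ) · sin((k − 2j)θ) dθ ] = (−1)^j · 2^{−4j} · binomial(k, j). -/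

import Mathlib

open Real MeasureTheory intervalIntegral ContDiff

/-- The action-angle coordinate `θ` as a function of the elliptic coordinate `φ`
and the caustic parameter `s = k_λ²`. -/
noncomputable def actionAngle (s φ : ℝ) : ℝ :=
  (π / 2) * (∫ τ in (0:ℝ)..φ, (1 - s * Real.sin τ ^ 2) ^ (-(1:ℝ)/2)) /
    (∫ τ in (0:ℝ)..(π/2), (1 - s * Real.sin τ ^ 2) ^ (-(1:ℝ)/2))

/-- The Taylor series at `0` of a function of a real variable. -/
noncomputable def taylorSeries (u : ℝ → ℂ) : PowerSeries ℂ :=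
  PowerSeries.mk fun n => iteratedDeriv n u 0 / (n.factorial : ℂ)

lemma coeff_taylorSeries (u : ℝ → ℂ) (n : ℕ) :
    PowerSeries.coeff n (taylorSeries u) = iteratedDeriv n u 0 / (n.factorial : ℂ) :=
  PowerSeries.coeff_mk _ _

lemma ContDiffAt.of_infty {u : ℝ → ℂ} {x : ℝ} (hu : ContDiffAt ℝ ∞ u x) (n : ℕ) :
    ContDiffAt ℝ n u x :=
  hu.of_le (by exact_mod_cast le_top)

lemma taylorSeries_mul {u v : ℝ → ℂ} (hu : ContDiffAt ℝ ∞ u 0) (hv : ContDiffAt ℝ ∞ v 0) :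
    taylorSeries (fun s => u s * v s) = taylorSeries u * taylorSeries v := by
  ext n
  rw [PowerSeries.coeff_mul, coeff_taylorSeries,
    iteratedDeriv_fun_mul (hu.of_infty n) (hv.of_infty n),
    Finset.Nat.sum_antidiagonal_eq_sum_range_succ_mk, Finset.sum_div]
  refine Finset.sum_congr rfl fun i hi => ?_
  have hi' : i ≤ n := Nat.lt_succ_iff.mp (Finset.mem_range.mp hi)
  simp only [coeff_taylorSeries]
  rw [Nat.cast_choose ℂ hi']
  have h1 : (n.factorial : ℂ) ≠ 0 := by exact_mod_cast n.factorial_ne_zero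
  have h2 : (i.factorial : ℂ) ≠ 0 := by exact_mod_cast i.factorial_ne_zero
  have h3 : ((n - i).factorial : ℂ) ≠ 0 := by exact_mod_cast (n - i).factorial_ne_zero
  field_simp

lemma taylorSeries_add {u v : ℝ → ℂ} (hu : ContDiffAt ℝ ∞ u 0) (hv : ContDiffAt ℝ ∞ v 0) :
    taylorSeries (fun s => u s + v s) = taylorSeries u + taylorSeries v := by
  ext n
  simp only [map_add, coeff_taylorSeries]
  rw [iteratedDeriv_fun_add (hu.of_infty n) (hv.of_infty n), add_div]

lemma taylorSeries_const (c : ℂ) : taylorSeries (fun _ => c) = PowerSeries.C c := by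
  ext n
  rw [coeff_taylorSeries, iteratedDeriv_const, PowerSeries.coeff_C]
  rcases eq_or_ne n 0 with rfl | h <;> simp [*]

lemma taylorSeries_const_mul {u : ℝ → ℂ} (hu : ContDiffAt ℝ ∞ u 0) (c : ℂ) :
    taylorSeries (fun s => c * u s) = PowerSeries.C c * taylorSeries u := by
  rw [taylorSeries_mul contDiffAt_const hu, taylorSeries_const]

lemma taylorSeries_sum {ι : Type*} (t : Finset ι) {u : ι → ℝ → ℂ}
    (hu : ∀ i ∈ t, ContDiffAt ℝ ∞ (u i) 0) :
    taylorSeries (fun s => ∑ i ∈ t, u i s) = ∑ i ∈ t, taylorSeries (u i) := by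
  classical
  induction t using Finset.induction_on with
  | empty => simp [taylorSeries_const]
  | insert a t ha ih =>
    simp only [Finset.sum_insert ha]
    rw [taylorSeries_add (hu a (by simp))
      (ContDiffAt.sum fun i hi => hu i (Finset.mem_insert_of_mem hi)),
      ih fun i hi => hu i (Finset.mem_insert_of_mem hi)]

lemma taylorSeries_ofReal : taylorSeries (fun s => (s : ℂ)) = PowerSeries.X := by
  have hd : deriv (fun s : ℝ => (s : ℂ)) = fun _ => 1 := by
    ext s
    exact (Complex.ofRealCLM.hasDerivAt (x := s)).deriv
  ext n
  rw [coeff_taylorSeries, PowerSeries.coeff_X]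
  rcases n with _ | n
  · simp
  · rw [iteratedDeriv_succ', hd, iteratedDeriv_const]
    rcases eq_or_ne n 0 with rfl | h <;> simp [*]

lemma contDiffAt_ofReal_pow (m : ℕ) (x : ℝ) : ContDiffAt ℝ ∞ (fun s : ℝ => (s : ℂ) ^ m) x :=
  (Complex.ofRealCLM.contDiff.contDiffAt).pow m

lemma taylorSeries_ofReal_pow (m : ℕ) :
    taylorSeries (fun s => (s : ℂ) ^ m) = PowerSeries.X ^ m := by
  induction m with
  | zero => simpa using taylorSeries_const 1
  | succ m ih =>
    simp only [pow_succ]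
    rw [taylorSeries_mul (contDiffAt_ofReal_pow m 0) (by simpa using contDiffAt_ofReal_pow 1 0),
      ih, taylorSeries_ofReal]

lemma taylorSeries_deriv (u : ℝ → ℂ) :
    taylorSeries (deriv u) = PowerSeries.derivative ℂ (taylorSeries u) := by
  ext n
  rw [PowerSeries.coeff_derivative, coeff_taylorSeries, coeff_taylorSeries, iteratedDeriv_succ',
    Nat.factorial_succ]
  have h1 : (n.factorial : ℂ) ≠ 0 := by exact_mod_cast n.factorial_ne_zero
  have h2 : (n : ℂ) + 1 ≠ 0 := by exact_mod_cast n.succ_ne_zero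
  push_cast
  field_simp

lemma taylorSeries_congr {u v : ℝ → ℂ} (h : u =ᶠ[nhds 0] v) :
    taylorSeries u = taylorSeries v := by
  ext n
  rw [coeff_taylorSeries, coeff_taylorSeries, h.iteratedDeriv_eq n]

lemma taylor_isLittleO_sum {u : ℝ → ℂ} (hu : ContDiffAt ℝ ∞ u 0) (n : ℕ) :
    (fun s : ℝ => u s - ∑ i ∈ Finset.range (n + 1),
      PowerSeries.coeff i (taylorSeries u) * (s : ℂ) ^ i) =o[nhds 0] fun s : ℝ => s ^ n := by
  obtain ⟨U, hU, hUc⟩ := (hu.of_infty n).contDiffOn le_rfl (by simp)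
  obtain ⟨r, hr, hrU⟩ := Metric.mem_nhds_iff.mp
    (show U ∈ nhds (0 : ℝ) by simpa using hU)
  have h0 : (0 : ℝ) ∈ Metric.ball (0 : ℝ) r := Metric.mem_ball_self hr
  have := taylor_isLittleO (convex_ball (0 : ℝ) r) h0 (hUc.mono hrU)
  rw [Metric.isOpen_ball.nhdsWithin_eq h0] at this
  refine (this.congr_left fun s => ?_).congr_right fun s => by simp
  rw [taylor_within_apply]
  congr 1
  refine Finset.sum_congr rfl fun i _ => ?_
  rw [iteratedDerivWithin_of_isOpen Metric.isOpen_ball h0, coeff_taylorSeries, sub_zero,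
    Complex.real_smul]
  push_cast
  ring

lemma coeff_taylorSeries_eq_zero_of_isBigO {u : ℝ → ℂ} (hu : ContDiffAt ℝ ∞ u 0) (n : ℕ)
    (h : u =O[nhds 0] fun s : ℝ => s ^ (n + 1)) :
    PowerSeries.coeff n (taylorSeries u) = 0 := by
  induction n using Nat.strong_induction_on with
  | _ n ih =>
    have hlow : ∀ i < n, PowerSeries.coeff i (taylorSeries u) = 0 := fun i hi =>
      ih i hi (h.trans (Asymptotics.IsLittleO.isBigO
        (Asymptotics.isLittleO_pow_pow (Nat.add_lt_add_right hi 1))))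
    have h1 := taylor_isLittleO_sum hu n
    have h2 : u =o[nhds 0] fun s : ℝ => s ^ n :=
      h.trans_isLittleO (Asymptotics.isLittleO_pow_pow (lt_add_one n))
    have h4 : (fun s : ℝ => PowerSeries.coeff n (taylorSeries u) * (s : ℂ) ^ n) =o[nhds 0]
        fun s : ℝ => s ^ n := by
      refine (h2.sub h1).congr_left fun s => ?_
      rw [Finset.sum_range_succ, Finset.sum_eq_zero fun i hi => by
        rw [hlow i (Finset.mem_range.mp hi), zero_mul]]
      ring
    by_contra hne
    have h5 : (fun s : ℝ => s ^ n) =o[nhds 0] fun s : ℝ => s ^ n :=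
      Asymptotics.IsLittleO.of_norm_left <|
        (Asymptotics.isLittleO_const_mul_left_iff hne).mp h4 |>.norm_left.congr_left
          fun s => by simp
    refine Asymptotics.isLittleO_irrefl ?_ h5
    have h6 : ∀ᶠ s : ℝ in nhdsWithin 0 {0}ᶜ, s ^ n ≠ 0 := by
      filter_upwards [self_mem_nhdsWithin] with s hs
      exact pow_ne_zero n hs
    exact h6.frequently.filter_mono nhdsWithin_le_nhds

/-- The exponential `θ ↦ e^{2ilθ}`. -/
noncomputable def expMode (l : ℤ) (θ : ℝ) : ℂ :=
  Complex.exp (2 * l * Complex.I * θ)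

lemma expMode_add (l m : ℤ) (θ : ℝ) : expMode (l + m) θ = expMode l θ * expMode m θ := by
  simp only [expMode, ← Complex.exp_add]
  congr 1
  push_cast
  ring

lemma expMode_one_pow (k : ℕ) (θ : ℝ) : expMode 1 θ ^ k = expMode k θ := by
  simp only [expMode, ← Complex.exp_nat_mul]
  congr 1
  push_cast
  ring

lemma expMode_zero (θ : ℝ) : expMode 0 θ = 1 := by simp [expMode]

lemma continuous_expMode (l : ℤ) : Continuous (expMode l) := by
  unfold expMode
  fun_prop

/-- `u` is a trigonometric polynomial in the `e^{2ilθ}` with `l ≥ -n`, and `c` is its coefficient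
at `e^{-2inθ}`. -/
def HasLowestMode (n : ℕ) (u : ℝ → ℂ) (c : ℂ) : Prop :=
  ∃ p : Polynomial ℂ, p.coeff 0 = c ∧ ∀ θ, u θ = expMode (-n) θ * p.eval (expMode 1 θ)

namespace HasLowestMode

lemma add {n : ℕ} {u v : ℝ → ℂ} {c d : ℂ} (hu : HasLowestMode n u c) (hv : HasLowestMode n v d) :
    HasLowestMode n (fun θ => u θ + v θ) (c + d) := by
  obtain ⟨p, hp, hpu⟩ := hu
  obtain ⟨q, hq, hqv⟩ := hv
  exact ⟨p + q, by simp [hp, hq], fun θ => by simp [hpu, hqv, mul_add]⟩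

lemma mul {n m : ℕ} {u v : ℝ → ℂ} {c d : ℂ} (hu : HasLowestMode n u c)
    (hv : HasLowestMode m v d) : HasLowestMode (n + m) (fun θ => u θ * v θ) (c * d) := by
  obtain ⟨p, hp, hpu⟩ := hu
  obtain ⟨q, hq, hqv⟩ := hv
  refine ⟨p * q, by simp [Polynomial.mul_coeff_zero, hp, hq], fun θ => ?_⟩
  simp only [hpu, hqv]
  rw [Nat.cast_add, neg_add, expMode_add, Polynomial.eval_mul]
  ring

lemma const_mul {n : ℕ} {u : ℝ → ℂ} {c : ℂ} (hu : HasLowestMode n u c) (a : ℂ) :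
    HasLowestMode n (fun θ => a * u θ) (a * c) := by
  obtain ⟨p, hp, hpu⟩ := hu
  exact ⟨Polynomial.C a * p, by simp [hp], fun θ => by simp [hpu]; ring⟩

lemma zero (n : ℕ) : HasLowestMode n (fun _ => 0) 0 := ⟨0, by simp, by simp⟩

lemma sum {ι : Type*} (t : Finset ι) {n : ℕ} {u : ι → ℝ → ℂ} {c : ι → ℂ}
    (h : ∀ i ∈ t, HasLowestMode n (u i) (c i)) :
    HasLowestMode n (fun θ => ∑ i ∈ t, u i θ) (∑ i ∈ t, c i) := by
  classical
  induction t using Finset.induction_on with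
  | empty => simpa using zero n
  | insert a t ha ih =>
    simp only [Finset.sum_insert ha]
    exact (h a (by simp)).add (ih fun i hi => h i (Finset.mem_insert_of_mem hi))

lemma of_lt {n m : ℕ} {u : ℝ → ℂ} {c : ℂ} (hu : HasLowestMode n u c) (hnm : n < m) :
    HasLowestMode m u 0 := by
  obtain ⟨p, hp, hpu⟩ := hu
  refine ⟨Polynomial.X ^ (m - n) * p, ?_, fun θ => ?_⟩
  · rw [Polynomial.mul_coeff_zero, Polynomial.coeff_X_pow, if_neg (by omega), zero_mul]
  · rw [hpu, Polynomial.eval_mul, Polynomial.eval_pow, Polynomial.eval_X, expMode_one_pow,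
      ← mul_assoc, ← expMode_add]
    congr 2
    omega

lemma expMode_nat_sub (n k : ℕ) :
    HasLowestMode n (expMode (k - n)) (if k = 0 then 1 else 0) := by
  refine ⟨Polynomial.X ^ k, ?_, fun θ => ?_⟩
  · rw [Polynomial.coeff_X_pow]
    simp [eq_comm]
  · rw [Polynomial.eval_pow, Polynomial.eval_X, expMode_one_pow, ← expMode_add]
    congr 1
    ring

lemma eq_sum {n : ℕ} {u : ℝ → ℂ} {c : ℂ} (hu : HasLowestMode n u c) :
    ∃ p : Polynomial ℂ, p.coeff 0 = c ∧ ∀ θ, u θ =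
      ∑ k ∈ Finset.range (p.natDegree + 1), p.coeff k * expMode (k - n) θ := by
  obtain ⟨p, hp, hpu⟩ := hu
  refine ⟨p, hp, fun θ => ?_⟩
  rw [hpu, Polynomial.eval_eq_sum_range, Finset.mul_sum]
  refine Finset.sum_congr rfl fun k _ => ?_
  rw [expMode_one_pow, sub_eq_add_neg, expMode_add]
  ring

lemma continuous {n : ℕ} {u : ℝ → ℂ} {c : ℂ} (hu : HasLowestMode n u c) : Continuous u := by
  obtain ⟨p, -, hpu⟩ := hu
  rw [funext hpu]
  exact (continuous_expMode _).mul (p.continuous.comp (continuous_expMode 1))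

end HasLowestMode

lemma integral_expMode (k : ℕ) :
    ∫ θ in (-π)..π, expMode k θ = if k = 0 then 2 * (π : ℂ) else 0 := by
  rcases eq_or_ne k 0 with rfl | hk
  · simp [expMode]
    ring
  · rw [if_neg hk]
    have hc : (2 * (k : ℤ) * Complex.I : ℂ) ≠ 0 := by simp [hk]
    unfold expMode
    rw [integral_exp_mul_complex hc, div_eq_zero_iff]
    left
    rw [sub_eq_zero, Complex.exp_eq_exp_iff_exists_int]
    exact ⟨2 * k, by push_cast; ring⟩

lemma HasLowestMode.integral {n : ℕ} {u : ℝ → ℂ} {c : ℂ} (hu : HasLowestMode n u c) :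
    ∫ θ in (-π)..π, expMode n θ * u θ = 2 * π * c := by
  obtain ⟨p, hp, hpu⟩ := hu.eq_sum
  have h : ∀ θ, expMode n θ * u θ =
      ∑ k ∈ Finset.range (p.natDegree + 1), p.coeff k * expMode k θ := fun θ => by
    rw [hpu, Finset.mul_sum]
    refine Finset.sum_congr rfl fun k _ => ?_
    rw [mul_left_comm, ← expMode_add]
    simp
  simp only [h]
  rw [intervalIntegral.integral_finsetSum fun (k : ℕ) _ =>
    ((continuous_expMode k).intervalIntegrable _ _).const_mul (p.coeff k)]
  simp only [intervalIntegral.integral_const_mul, integral_expMode]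
  simp [hp]
  ring

/-- The mean value of `sin ^ (2 * m)`. -/
noncomputable def sinPowMean (m : ℕ) : ℝ :=
  ∏ i ∈ Finset.range m, (2 * (i : ℝ) + 1) / (2 * i + 2)

lemma integral_sin_pow_even_pi_div_two (m : ℕ) :
    ∫ τ in (0 : ℝ)..(π / 2), Real.sin τ ^ (2 * m) = sinPowMean m * (π / 2) := by
  induction m with
  | zero => simp [sinPowMean]
  | succ m ih =>
    rw [mul_add, mul_one, integral_sin_pow, ih, sinPowMean, sinPowMean, Finset.prod_range_succ]
    simp
    ring

lemma hasLowestMode_sin_sq :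
    HasLowestMode 1 (fun φ => (Real.sin φ : ℂ) ^ 2) (-1 / 4) := by
  have h := (((HasLowestMode.expMode_nat_sub 1 0).const_mul (-1 / 4)).add
    ((HasLowestMode.expMode_nat_sub 1 1).const_mul (1 / 2))).add
    ((HasLowestMode.expMode_nat_sub 1 2).const_mul (-1 / 4))
  norm_num at h
  rw [neg_div]
  convert h using 2 with φ
  rw [Complex.ofReal_sin, Complex.sin]
  have h1 : Complex.exp (φ * Complex.I) * Complex.exp (-φ * Complex.I) = 1 := by
    rw [← Complex.exp_add]; simp
  have h2 : expMode 1 φ = Complex.exp (φ * Complex.I) ^ 2 := by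
    rw [expMode, ← Complex.exp_nat_mul]; congr 1; push_cast; ring
  have h3 : expMode (-1) φ = Complex.exp (-φ * Complex.I) ^ 2 := by
    rw [expMode, ← Complex.exp_nat_mul]; congr 1; push_cast; ring
  rw [h2, h3, expMode_zero]
  linear_combination (Complex.exp (-φ * Complex.I) - Complex.exp (φ * Complex.I)) ^ 2 / 4 *
    Complex.I_sq + (1 / 2) * h1

lemma hasLowestMode_sin_mul_cos :
    HasLowestMode 1 (fun φ => (Real.sin φ : ℂ) * Real.cos φ) (Complex.I / 4) := by
  have h := ((HasLowestMode.expMode_nat_sub 1 0).const_mul (Complex.I / 4)).add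
    ((HasLowestMode.expMode_nat_sub 1 2).const_mul (-Complex.I / 4))
  norm_num at h
  convert h using 2 with φ
  rw [Complex.ofReal_sin, Complex.sin, Complex.ofReal_cos, Complex.cos]
  have h2 : expMode 1 φ = Complex.exp (φ * Complex.I) ^ 2 := by
    rw [expMode, ← Complex.exp_nat_mul]; congr 1; push_cast; ring
  have h3 : expMode (-1) φ = Complex.exp (-φ * Complex.I) ^ 2 := by
    rw [expMode, ← Complex.exp_nat_mul]; congr 1; push_cast; ring
  rw [h2, h3]
  ring

lemma hasLowestMode_sin_pow (m : ℕ) :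
    HasLowestMode m (fun φ => (Real.sin φ : ℂ) ^ (2 * m)) ((-1 / 4) ^ m) := by
  induction m with
  | zero => simpa [funext expMode_zero] using HasLowestMode.expMode_nat_sub 0 0
  | succ m ih =>
    simpa only [mul_add, mul_one, pow_add, pow_one] using ih.mul hasLowestMode_sin_sq

/-- The primitive of `sin ^ (2 * m)` minus its linear part. -/
noncomputable def sinPowOsc (m : ℕ) (φ : ℝ) : ℝ :=
  (∫ τ in (0 : ℝ)..φ, Real.sin τ ^ (2 * m)) - sinPowMean m * φ

lemma hasLowestMode_sinPowOsc (m : ℕ) :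
    HasLowestMode m (fun φ => (sinPowOsc m φ : ℂ)) (Complex.I * (-1 / 4) ^ m / (2 * m)) := by
  induction m with
  | zero => simpa [sinPowOsc, sinPowMean] using HasLowestMode.zero 0
  | succ m ih =>
    have hm : ((m : ℂ) + 1) ≠ 0 := by exact_mod_cast m.succ_ne_zero
    have h := ((ih.of_lt (lt_add_one m)).const_mul ((2 * m + 1) / (2 * m + 2))).add
      (((hasLowestMode_sin_pow m).mul hasLowestMode_sin_mul_cos).const_mul (-1 / (2 * m + 2)))
    convert h using 1
    · funext φ
      rw [sinPowOsc, sinPowOsc, mul_add, mul_one, integral_sin_pow, sinPowMean,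
        Finset.prod_range_succ, ← sinPowMean]
      have hm' : (2 * (m : ℂ) + 2) ≠ 0 := by
        rw [show (2 * (m : ℂ) + 2) = 2 * (m + 1) by ring]; exact mul_ne_zero two_ne_zero hm
      push_cast
      simp only [Complex.sin_zero]
      field_simp
      ring
    · push_cast
      rw [show (2 * (m : ℂ) + 2) = 2 * (m + 1) by ring]
      field_simp
      ring

/-- The Taylor coefficients of `(1 - x / 16) ^ l`. -/
noncomputable def leadCoeff (l : ℂ) : ℕ → ℂ
  | 0 => 1
  | n + 1 => leadCoeff l n * (n - l) / (16 * (n + 1))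

lemma leadCoeff_natCast (k j : ℕ) :
    leadCoeff k j = (-1) ^ j * ((2 : ℂ) ^ (4 * j))⁻¹ * (k.choose j : ℂ) := by
  induction j with
  | zero => simp [leadCoeff]
  | succ j ih =>
    have hj : ((j : ℂ) + 1) ≠ 0 := by exact_mod_cast j.succ_ne_zero
    have h : (k.choose (j + 1) : ℂ) * (j + 1) = k.choose j * (k - j) := by
      rcases le_or_gt j k with hjk | hjk
      · rw [← Nat.cast_sub hjk]
        exact_mod_cast Nat.choose_succ_right_eq k j
      · simp [Nat.choose_eq_zero_of_lt hjk, Nat.choose_eq_zero_of_lt (hjk.trans (lt_add_one j))]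
    rw [leadCoeff, ih, mul_add 4 j 1, pow_add (2 : ℂ)]
    field_simp
    linear_combination (-1) ^ j * 16 * h

lemma leadCoeff_neg (m r : ℕ) :
    leadCoeff (-(2 * (m + 1))) r = ((2 * m + 1 + r).choose r : ℂ) / 16 ^ r := by
  induction r with
  | zero => simp [leadCoeff]
  | succ r ih =>
    have hr : ((r : ℂ) + 1) ≠ 0 := by exact_mod_cast r.succ_ne_zero
    have h : ((2 * m + 1 + (r + 1)).choose (r + 1) : ℂ) * (r + 1) =
        (2 * m + 1 + r + 1) * (2 * m + 1 + r).choose r := by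
      exact_mod_cast (Nat.add_one_mul_choose_eq (2 * m + 1 + r) r).symm
    rw [leadCoeff, ih, pow_succ]
    field_simp
    linear_combination -h

lemma succ_mul_leadCoeff_succ (l : ℂ) (n : ℕ) :
    (n + 1) * leadCoeff l (n + 1) =
      -l * ∑ b ∈ Finset.range (n + 1), leadCoeff l b / 16 ^ (n - b + 1) := by
  induction n with
  | zero => simp [leadCoeff]; ring
  | succ n ih =>
    have hn : ((n : ℂ) + 1) ≠ 0 := by exact_mod_cast n.succ_ne_zero
    have hn' : ((n : ℂ) + 1 + 1) ≠ 0 := by exact_mod_cast (n + 1).succ_ne_zero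
    have hs : ∑ b ∈ Finset.range (n + 1), leadCoeff l b / 16 ^ (n + 1 - b + 1) =
        (∑ b ∈ Finset.range (n + 1), leadCoeff l b / 16 ^ (n - b + 1)) / 16 := by
      rw [Finset.sum_div]
      refine Finset.sum_congr rfl fun b hb => ?_
      rw [show n + 1 - b + 1 = (n - b + 1) + 1 by have := Finset.mem_range.mp hb; omega, pow_succ,
        div_div]
    rw [Finset.sum_range_succ, hs, mul_add, mul_div_assoc', ← ih, leadCoeff]
    push_cast
    simp
    field_simp
    ring

lemma sum_neg_one_pow_mul_choose (n M : ℕ) :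
    ∑ m ∈ Finset.range (M + 1), (-1 : ℤ) ^ m * ((n + 1).choose m * (n + m).choose m) =
      (-1) ^ M * (n.choose M * (n + 1 + M).choose M) := by
  induction M with
  | zero => simp
  | succ M ih =>
    rw [Finset.sum_range_succ, ih]
    have h1 : (n + 1).choose (M + 1) = n.choose M + n.choose (M + 1) := Nat.choose_succ_succ _ _
    have h2 : (n + 1 + (M + 1)).choose (M + 1) =
      (n + 1 + M).choose M + (n + 1 + M).choose (M + 1) := Nat.choose_succ_succ _ _
    have h3 : n + (M + 1) = n + 1 + M := by ring
    have h4 : (n + 1 + M).choose (M + 1) * (M + 1) = (n + 1 + M).choose M * (n + 1) := by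
      rw [Nat.choose_succ_right_eq]; congr 1; omega
    have h5 : (n + 1) * n.choose M = (n + 1).choose (M + 1) * (M + 1) :=
      Nat.add_one_mul_choose_eq n M
    rw [h3, h2]
    zify at h1 h4 h5
    have hM : ((M : ℤ) + 1) ≠ 0 := by positivity
    apply mul_left_cancel₀ hM
    push_cast
    linear_combination (-1 : ℤ) ^ M * (-((n + 1 + M).choose M : ℤ) * h5 - n.choose M * h4
      - (M + 1) * ((n + 1 + M).choose M + (n + 1 + M).choose (M + 1)) * h1)

/-- The Taylor coefficients of `(1 - x) ^ (-1 / 2)`. -/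
noncomputable def invSqrtCoeff (m : ℕ) : ℝ := Ring.choose (-(1 : ℝ) / 2) m * (-1) ^ m

lemma invSqrtCoeff_eq (m : ℕ) : invSqrtCoeff m = (m.centralBinom : ℝ) / 4 ^ m := by
  induction m with
  | zero => simp [invSqrtCoeff]
  | succ m ih =>
    have h := Ring.choose_smul_choose (-(1 : ℝ) / 2) (Nat.le_succ m)
    have h2 : ((m : ℝ) + 1) * (m + 1).centralBinom = 2 * (2 * m + 1) * m.centralBinom := by
      exact_mod_cast Nat.succ_mul_centralBinom_succ m
    simp only [Nat.choose_succ_self_right, Nat.succ_eq_add_one, Nat.add_sub_cancel_left,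
      Ring.choose_one_right, nsmul_eq_mul] at h
    rw [invSqrtCoeff] at ih ⊢
    have hm : ((m : ℝ) + 1) ≠ 0 := by positivity
    have h3 : Ring.choose (-(1 : ℝ) / 2) m * (-1) ^ m * 4 ^ m = m.centralBinom := by
      rw [ih]; field_simp
    rw [eq_div_iff (by positivity)]
    apply mul_left_cancel₀ hm
    rw [h2, ← h3]
    push_cast at h
    rw [pow_succ, pow_succ]
    linear_combination (-4) * (-1) ^ m * 4 ^ m * h

lemma neg_sum_leadCoeff_eq (N : ℕ) :
    -∑ m ∈ Finset.range (N + 1), (invSqrtCoeff (m + 1) : ℂ) *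
      (leadCoeff (-(2 * (m + 1))) (N - m) *
        (Complex.I * (-1 / 4) ^ (m + 1) / (2 * ((m + 1 : ℕ) : ℂ)))) =
      Complex.I / ((N + 1) * 16 ^ (N + 1)) := by
  have hN : ((N : ℂ) + 1) ≠ 0 := by exact_mod_cast N.succ_ne_zero
  have key : ∀ m ∈ Finset.range (N + 1), (invSqrtCoeff (m + 1) : ℂ) *
      (leadCoeff (-(2 * (m + 1))) (N - m) *
        (Complex.I * (-1 / 4) ^ (m + 1) / (2 * ((m + 1 : ℕ) : ℂ)))) =
      Complex.I / ((N + 1) * 16 ^ (N + 1)) *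
        (((-1 : ℤ) ^ (m + 1) * ((N + 1).choose (m + 1) * (N + (m + 1)).choose (m + 1)) :
          ℤ) : ℂ) := by
    intro m hm
    obtain ⟨r, rfl⟩ := Nat.exists_eq_add_of_le (Nat.lt_succ_iff.mp (Finset.mem_range.mp hm))
    rw [Nat.add_sub_cancel_left, leadCoeff_neg, invSqrtCoeff_eq, Nat.centralBinom]
    have h1 : ((2 * (m + 1)).choose (m + 1) : ℂ) =
        (2 * m + 2).factorial / ((m + 1).factorial * (m + 1).factorial) := by
      rw [Nat.cast_choose ℂ (by omega)]
      congr 4; omega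
    have h2 : ((2 * m + 1 + r).choose r : ℂ) =
        (2 * m + 1 + r).factorial / (r.factorial * (2 * m + 1).factorial) := by
      rw [Nat.cast_choose ℂ (by omega)]
      congr 4; omega
    have h3 : ((m + r + 1).choose (m + 1) : ℂ) =
        (m + r + 1).factorial / ((m + 1).factorial * r.factorial) := by
      rw [Nat.cast_choose ℂ (by omega)]
      congr 4; omega
    have h4 : ((m + r + (m + 1)).choose (m + 1) : ℂ) =
        (2 * m + 1 + r).factorial / ((m + 1).factorial * (m + r).factorial) := by
      rw [show m + r + (m + 1) = 2 * m + 1 + r by ring, Nat.cast_choose ℂ (by omega),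
        show 2 * m + 1 + r - (m + 1) = m + r by omega]
    push_cast at hN ⊢
    have hm1 : ((m : ℂ) + 1) ≠ 0 := by exact_mod_cast m.succ_ne_zero
    rw [h1, h2, h3, h4, Nat.factorial_succ (2 * m + 1), Nat.factorial_succ (m + r)]
    have f1 : (r.factorial : ℂ) ≠ 0 := by exact_mod_cast r.factorial_ne_zero
    have f2 : ((m + 1).factorial : ℂ) ≠ 0 := by exact_mod_cast (m + 1).factorial_ne_zero
    have f3 : ((m + r).factorial : ℂ) ≠ 0 := by exact_mod_cast (m + r).factorial_ne_zero
    have f4 : ((2 * m + 1).factorial : ℂ) ≠ 0 := by exact_mod_cast (2 * m + 1).factorial_ne_zero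
    rw [div_pow, show (16 : ℂ) ^ (m + r + 1) = 4 ^ (m + 1) * 4 ^ (m + 1) * 16 ^ r by
      rw [← mul_pow, show m + r + 1 = (m + 1) + r by ring, pow_add]; norm_num]
    push_cast
    field_simp
    ring
  rw [Finset.sum_congr rfl key, ← Finset.mul_sum, ← Int.cast_sum]
  have h := sum_neg_one_pow_mul_choose N (N + 1)
  rw [Finset.sum_range_succ'] at h
  simp only [Nat.choose_succ_self, Nat.cast_zero, zero_mul, mul_zero, pow_zero,
    Nat.choose_zero_right, Nat.cast_one, one_mul] at h
  rw [eq_neg_of_add_eq_zero_left h]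
  simp

lemma isBigO_invSqrt_sub_sum (N : ℕ) :
    (fun x : ℝ => (1 - x) ^ (-(1 : ℝ) / 2) - ∑ m ∈ Finset.range N, invSqrtCoeff m * x ^ m)
      =O[nhds 0] fun x => x ^ N := by
  have h := (Real.one_add_rpow_hasFPowerSeriesAt_zero
    (a := -(1 : ℝ) / 2)).isBigO_sub_partialSum_pow N
  have ht : Filter.Tendsto (fun x : ℝ => -x) (nhds 0) (nhds 0) := by
    simpa using (continuous_neg (G := ℝ)).tendsto 0
  refine Asymptotics.IsBigO.of_norm_right ?_
  refine ((h.comp_tendsto ht).congr_left fun x => ?_).congr_right fun x => ?_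
  · simp only [Function.comp, zero_add, FormalMultilinearSeries.partialSum, invSqrtCoeff,
      binomialSeries_apply, List.ofFn_const, List.prod_replicate, smul_eq_mul]
    rw [← sub_eq_add_neg]
    congr 1
    refine Finset.sum_congr rfl fun m _ => ?_
    rw [neg_pow]
    ring
  · simp

lemma one_sub_mul_sin_sq_pos {s : ℝ} (hs : |s| < 1) (τ : ℝ) : 0 < 1 - s * Real.sin τ ^ 2 := by
  have h1 : s * Real.sin τ ^ 2 ≤ |s| * Real.sin τ ^ 2 :=
    mul_le_mul_of_nonneg_right (le_abs_self s) (sq_nonneg _)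
  have h2 : |s| * Real.sin τ ^ 2 ≤ |s| :=
    mul_le_of_le_one_right (abs_nonneg s) (Real.sin_sq_le_one τ)
  linarith

lemma continuous_invSqrt_sin {s : ℝ} (hs : |s| < 1) :
    Continuous fun τ : ℝ => (1 - s * Real.sin τ ^ 2) ^ (-(1 : ℝ) / 2) :=
  Continuous.rpow_const (by fun_prop) fun τ => Or.inl (one_sub_mul_sin_sq_pos hs τ).ne'

lemma exists_integral_invSqrt_sub_le (N : ℕ) : ∃ C r : ℝ, 0 < r ∧ ∀ s φ : ℝ, |s| < r → |s| < 1 →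
    |(∫ τ in (0 : ℝ)..φ, (1 - s * Real.sin τ ^ 2) ^ (-(1 : ℝ) / 2)) -
      ∑ m ∈ Finset.range N, invSqrtCoeff m * s ^ m * ∫ τ in (0 : ℝ)..φ, Real.sin τ ^ (2 * m)|
      ≤ C * |s| ^ N * |φ| := by
  obtain ⟨C, hC0, hC⟩ := (isBigO_invSqrt_sub_sum N).exists_nonneg
  obtain ⟨r, hr, hball⟩ := Metric.eventually_nhds_iff_ball.mp hC.bound
  refine ⟨C, r, hr, fun s φ hs hs1 => ?_⟩
  have hsum : ∑ m ∈ Finset.range N, invSqrtCoeff m * s ^ m * ∫ τ in (0 : ℝ)..φ,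
      Real.sin τ ^ (2 * m) = ∫ τ in (0 : ℝ)..φ,
        ∑ m ∈ Finset.range N, invSqrtCoeff m * (s * Real.sin τ ^ 2) ^ m := by
    rw [intervalIntegral.integral_finsetSum fun m _ =>
      Continuous.intervalIntegrable (by fun_prop) _ _]
    refine Finset.sum_congr rfl fun m _ => ?_
    rw [← intervalIntegral.integral_const_mul]
    refine intervalIntegral.integral_congr fun τ _ => ?_
    simp only [mul_pow, pow_mul]
    ring
  rw [hsum, ← intervalIntegral.integral_sub ((continuous_invSqrt_sin hs1).intervalIntegrable _ _)
    (Continuous.intervalIntegrable (by fun_prop) _ _), ← Real.norm_eq_abs]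
  have h := intervalIntegral.norm_integral_le_of_norm_le_const (a := 0) (b := φ)
    (C := C * |s| ^ N) (f := fun τ => (1 - s * Real.sin τ ^ 2) ^ (-(1 : ℝ) / 2) -
      ∑ m ∈ Finset.range N, invSqrtCoeff m * (s * Real.sin τ ^ 2) ^ m) fun τ _ => by
    have hle : |s * Real.sin τ ^ 2| ≤ |s| := by
      rw [abs_mul, abs_of_nonneg (sq_nonneg (Real.sin τ))]
      exact mul_le_of_le_one_right (abs_nonneg s) (Real.sin_sq_le_one τ)
    refine (hball (s * Real.sin τ ^ 2) (by simpa using hle.trans_lt hs)).trans ?_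
    rw [norm_pow, Real.norm_eq_abs]
    gcongr
  simpa using h

section AmplitudeExpansion

variable {ε : ℝ} {g : ℝ → ℝ → ℝ}

/-- The Taylor series in `s` of `e^{il(g(s, θ) - θ)}`. -/
noncomputable def expSeries (g : ℝ → ℝ → ℝ) (l : ℤ) (θ : ℝ) : PowerSeries ℂ :=
  taylorSeries fun s => Complex.exp (l * Complex.I * (g s θ - θ))

/-- The Taylor series in `s` of `g(s, θ) - θ`. -/
noncomputable def shiftSeries (g : ℝ → ℝ → ℝ) (θ : ℝ) : PowerSeries ℂ :=
  taylorSeries fun s => (g s θ : ℂ) - θ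

lemma contDiffAt_shift {θ : ℝ} (hg : ContDiffAt ℝ ∞ (fun s => g s θ) 0) :
    ContDiffAt ℝ ∞ (fun s => (g s θ : ℂ) - θ) 0 :=
  (Complex.ofRealCLM.contDiff.contDiffAt.comp 0 hg).sub contDiffAt_const

lemma contDiffAt_exp_shift {θ : ℝ} (hg : ContDiffAt ℝ ∞ (fun s => g s θ) 0) (l : ℤ) :
    ContDiffAt ℝ ∞ (fun s => Complex.exp (l * Complex.I * (g s θ - θ))) 0 :=
  (contDiffAt_const.mul (contDiffAt_shift hg)).cexp

lemma coeff_zero_shiftSeries {θ : ℝ} (hg0 : g 0 θ = θ) :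
    PowerSeries.coeff 0 (shiftSeries g θ) = 0 := by
  rw [shiftSeries, coeff_taylorSeries]
  simp [hg0]

lemma coeff_zero_expSeries {θ : ℝ} (hg0 : g 0 θ = θ) (l : ℤ) :
    PowerSeries.coeff 0 (expSeries g l θ) = 1 := by
  rw [expSeries, coeff_taylorSeries]
  simp [hg0]

lemma coeff_succ_expSeries {θ : ℝ} (hg : ContDiffAt ℝ ∞ (fun s => g s θ) 0) (l : ℤ) (n : ℕ) :
    PowerSeries.coeff (n + 1) (expSeries g l θ) = l * Complex.I / (n + 1) *
      ∑ b ∈ Finset.range (n + 1), (n - b + 1 : ℕ) *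
        PowerSeries.coeff (n - b + 1) (shiftSeries g θ) *
          PowerSeries.coeff b (expSeries g l θ) := by
  have hd : deriv (fun s => Complex.exp (l * Complex.I * (g s θ - θ))) =ᶠ[nhds 0]
      fun s => l * Complex.I * (Complex.exp (l * Complex.I * (g s θ - θ)) *
        deriv (fun s => (g s θ : ℂ) - θ) s) := by
    filter_upwards [((contDiffAt_shift hg).of_infty 1).eventually (by simp)] with s hs
    have h := ((hs.differentiableAt (by simp)).hasDerivAt.const_mul (l * Complex.I)).cexp
    rw [h.deriv]
    ring
  have hd' : ContDiffAt ℝ ∞ (deriv fun s => (g s θ : ℂ) - θ) 0 :=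
    (contDiffAt_shift hg).derivWithin (by simp)
  have h := taylorSeries_congr hd
  rw [taylorSeries_deriv, taylorSeries_const_mul ((contDiffAt_exp_shift hg l).mul hd'),
    taylorSeries_mul (contDiffAt_exp_shift hg l) hd', taylorSeries_deriv] at h
  have hc := congrArg (PowerSeries.coeff n) h
  rw [PowerSeries.coeff_derivative, PowerSeries.coeff_C_mul, PowerSeries.coeff_mul,
    Finset.Nat.sum_antidiagonal_eq_sum_range_succ_mk] at hc
  have hn : ((n : ℂ) + 1) ≠ 0 := by exact_mod_cast n.succ_ne_zero
  rw [div_mul_eq_mul_div, eq_div_iff hn]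
  refine hc.trans ?_
  congr 1
  refine Finset.sum_congr rfl fun b hb => ?_
  rw [PowerSeries.coeff_derivative]
  simp only [expSeries, shiftSeries]
  push_cast
  ring

lemma expMode_comp (l : ℤ) (θ : ℝ) :
    (fun s => expMode l (g s θ)) = fun s => expMode l θ *
      Complex.exp ((2 * l : ℤ) * Complex.I * (g s θ - θ)) := by
  funext s
  simp only [expMode, ← Complex.exp_add]
  congr 1
  push_cast
  ring

lemma contDiffAt_expMode_comp {θ : ℝ} (hg : ContDiffAt ℝ ∞ (fun s => g s θ) 0) (l : ℤ) :
    ContDiffAt ℝ ∞ (fun s => expMode l (g s θ)) 0 := by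
  rw [expMode_comp]
  exact contDiffAt_const.mul (contDiffAt_exp_shift hg _)

lemma taylorSeries_expMode_comp {θ : ℝ} (hg : ContDiffAt ℝ ∞ (fun s => g s θ) 0) (l : ℤ) :
    taylorSeries (fun s => expMode l (g s θ)) =
      PowerSeries.C (expMode l θ) * expSeries g (2 * l) θ := by
  rw [expMode_comp, taylorSeries_const_mul (contDiffAt_exp_shift hg _), expSeries]

lemma HasLowestMode.contDiffAt_comp {n : ℕ} {u : ℝ → ℂ} {c : ℂ} (hu : HasLowestMode n u c)
    {θ : ℝ} (hg : ContDiffAt ℝ ∞ (fun s => g s θ) 0) :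
    ContDiffAt ℝ ∞ (fun s => u (g s θ)) 0 := by
  obtain ⟨p, -, hpu⟩ := hu.eq_sum
  simp only [hpu]
  exact ContDiffAt.sum fun k _ => contDiffAt_const.mul (contDiffAt_expMode_comp hg _)

lemma HasLowestMode.coeff_comp {n : ℕ} {u : ℝ → ℂ} {c : ℂ} (hu : HasLowestMode n u c)
    (hg : ∀ θ, ContDiffAt ℝ ∞ (fun s => g s θ) 0) {r : ℕ}
    (hr : ∀ l : ℤ, HasLowestMode r (fun θ => PowerSeries.coeff r (expSeries g l θ))
      (leadCoeff l r)) :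
    HasLowestMode (n + r) (fun θ => PowerSeries.coeff r (taylorSeries fun s => u (g s θ)))
      (leadCoeff (-(2 * n)) r * c) := by
  obtain ⟨p, hp, hpu⟩ := hu.eq_sum
  have h : HasLowestMode (n + r) (fun θ => ∑ k ∈ Finset.range (p.natDegree + 1), p.coeff k *
      (expMode (k - n) θ * PowerSeries.coeff r (expSeries g (2 * (k - n)) θ))) _ :=
    HasLowestMode.sum _ fun k _ =>
      ((HasLowestMode.expMode_nat_sub n k).mul (hr (2 * (k - n)))).const_mul (p.coeff k)
  convert h using 1
  · funext θ
    simp only [hpu]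
    rw [taylorSeries_sum _ fun k _ => contDiffAt_const.mul (contDiffAt_expMode_comp (hg θ) _),
      map_sum]
    refine Finset.sum_congr rfl fun k _ => ?_
    rw [taylorSeries_const_mul (contDiffAt_expMode_comp (hg θ) _),
      taylorSeries_expMode_comp (hg θ), PowerSeries.coeff_C_mul, PowerSeries.coeff_C_mul]
  · simp [hp, mul_comm]

lemma isBigO_sum_sinPowOsc {θ : ℝ} (hε0 : 0 < ε) (hε1 : ε < 1)
    (hg : ContDiffAt ℝ ∞ (fun s => g s θ) 0)
    (hinv : ∀ s : ℝ, |s| < ε → actionAngle s (g s θ) = θ) (N : ℕ) :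
    (fun s => ∑ m ∈ Finset.range N, invSqrtCoeff m * s ^ m *
      (sinPowOsc m (g s θ) + sinPowMean m * (g s θ - θ))) =O[nhds 0] fun s => s ^ N := by
  obtain ⟨C, r, hr, hC⟩ := exists_integral_invSqrt_sub_le N
  have hb : ∀ᶠ s in nhds 0, |g s θ| < |g 0 θ| + 1 :=
    (hg.continuousAt.abs).eventually_lt continuousAt_const (lt_add_one _)
  refine Asymptotics.IsBigO.of_bound (C * (|g 0 θ| + 1) + C * |θ|) ?_
  filter_upwards [hb, Metric.ball_mem_nhds (0 : ℝ) hr, Metric.ball_mem_nhds (0 : ℝ) hε0]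
    with s hs1 hs2 hs3
  have hsr : |s| < r := by simpa using hs2
  have hsε : |s| < ε := by simpa using hs3
  have hpi := Real.pi_pos
  set F : ℝ → ℝ := fun φ => ∫ τ in (0 : ℝ)..φ, (1 - s * Real.sin τ ^ 2) ^ (-(1 : ℝ) / 2) with hF
  have hK : 0 < F (π / 2) := intervalIntegral.intervalIntegral_pos_of_pos
    ((continuous_invSqrt_sin (hsε.trans hε1)).intervalIntegrable _ _)
    (fun τ => Real.rpow_pos_of_pos (one_sub_mul_sin_sq_pos (hsε.trans hε1) τ) _) (by positivity)
  have hrel : F (g s θ) = 2 / π * θ * F (π / 2) := by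
    have h := hinv s hsε
    change π / 2 * F (g s θ) / F (π / 2) = θ at h
    rw [div_eq_iff hK.ne'] at h
    field_simp
    linarith
  have h1 := hC s (g s θ) hsr (hsε.trans hε1)
  have h2 := hC s (π / 2) hsr (hsε.trans hε1)
  change |F (g s θ) - _| ≤ _ at h1
  change |F (π / 2) - _| ≤ _ at h2
  simp only [integral_sin_pow_even_pi_div_two] at h2
  have hsplit : ∑ m ∈ Finset.range N, invSqrtCoeff m * s ^ m *
      (sinPowOsc m (g s θ) + sinPowMean m * (g s θ - θ)) =
      2 / π * θ * (F (π / 2) - ∑ m ∈ Finset.range N,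
        invSqrtCoeff m * s ^ m * (sinPowMean m * (π / 2))) -
      (F (g s θ) - ∑ m ∈ Finset.range N,
        invSqrtCoeff m * s ^ m * ∫ τ in (0 : ℝ)..(g s θ), Real.sin τ ^ (2 * m)) := by
    rw [mul_sub, ← hrel, sub_sub_sub_cancel_left, Finset.mul_sum, ← Finset.sum_sub_distrib]
    refine Finset.sum_congr rfl fun m _ => ?_
    rw [sinPowOsc]
    field_simp
    ring
  have hCN : 0 ≤ C * |s| ^ N := by
    rcases (abs_nonneg (π / 2)).eq_or_lt with h | h
    · rw [abs_of_pos (by positivity)] at h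
      linarith
    · exact nonneg_of_mul_nonneg_left ((abs_nonneg _).trans h2) h
  rw [hsplit, Real.norm_eq_abs, norm_pow, Real.norm_eq_abs]
  refine (abs_sub _ _).trans ?_
  rw [abs_mul, abs_mul, abs_of_pos (show 0 < 2 / π by positivity)]
  rw [abs_of_pos (show 0 < π / 2 by positivity)] at h2
  calc 2 / π * |θ| * _ + _ ≤
        2 / π * |θ| * (C * |s| ^ N * (π / 2)) + C * |s| ^ N * (|g 0 θ| + 1) := by
        gcongr
        exact h1.trans (by gcongr)
    _ = _ := by
        field_simp
        ring

lemma coeff_shiftSeries {θ : ℝ} (hε0 : 0 < ε) (hε1 : ε < 1)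
    (hg : ContDiffAt ℝ ∞ (fun s => g s θ) 0)
    (hinv : ∀ s : ℝ, |s| < ε → actionAngle s (g s θ) = θ) (N : ℕ) :
    PowerSeries.coeff (N + 1) (shiftSeries g θ) =
      -∑ m ∈ Finset.range (N + 1), (invSqrtCoeff (m + 1) : ℂ) *
        (PowerSeries.coeff (N - m) (taylorSeries fun s => (sinPowOsc (m + 1) (g s θ) : ℂ)) +
          sinPowMean (m + 1) * PowerSeries.coeff (N - m) (shiftSeries g θ)) := by
  have ho : ∀ m, ContDiffAt ℝ ∞ (fun s => (sinPowOsc m (g s θ) : ℂ)) 0 := fun m =>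
    (hasLowestMode_sinPowOsc m).contDiffAt_comp hg
  have hd := contDiffAt_shift hg
  have hterm : ∀ m, ContDiffAt ℝ ∞ (fun s : ℝ => (invSqrtCoeff m : ℂ) * ((s : ℂ) ^ m *
      ((sinPowOsc m (g s θ) : ℂ) + sinPowMean m * ((g s θ : ℂ) - θ)))) 0 := fun m =>
    contDiffAt_const.mul ((contDiffAt_ofReal_pow m 0).mul ((ho m).add (contDiffAt_const.mul hd)))
  have hO := isBigO_sum_sinPowOsc hε0 hε1 hg hinv (N + 2)
  have hz := coeff_taylorSeries_eq_zero_of_isBigO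
    (u := fun s : ℝ => ∑ m ∈ Finset.range (N + 2), (invSqrtCoeff m : ℂ) * ((s : ℂ) ^ m *
      ((sinPowOsc m (g s θ) : ℂ) + sinPowMean m * ((g s θ : ℂ) - θ))))
    (ContDiffAt.sum fun m _ => hterm m) (N + 1) (by
      refine Asymptotics.IsBigO.of_norm_left (hO.norm_left.congr_left fun s => ?_)
      rw [← Complex.norm_real]
      push_cast
      simp only [mul_assoc])
  have hcoeff : ∀ m ∈ Finset.range (N + 2), PowerSeries.coeff (N + 1) (taylorSeries fun s : ℝ =>
      (invSqrtCoeff m : ℂ) * ((s : ℂ) ^ m *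
        ((sinPowOsc m (g s θ) : ℂ) + sinPowMean m * ((g s θ : ℂ) - θ)))) =
      (invSqrtCoeff m : ℂ) *
        (PowerSeries.coeff (N + 1 - m) (taylorSeries fun s => (sinPowOsc m (g s θ) : ℂ)) +
          sinPowMean m * PowerSeries.coeff (N + 1 - m) (shiftSeries g θ)) := fun m hm => by
    rw [taylorSeries_const_mul ((contDiffAt_ofReal_pow m 0).mul
      ((ho m).add (contDiffAt_const.mul hd))), taylorSeries_mul (contDiffAt_ofReal_pow m 0)
      ((ho m).add (contDiffAt_const.mul hd)), taylorSeries_add (ho m) (contDiffAt_const.mul hd),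
      taylorSeries_const_mul hd, taylorSeries_ofReal_pow, PowerSeries.coeff_C_mul,
      PowerSeries.coeff_X_pow_mul', if_pos (Nat.lt_succ_iff.mp (Finset.mem_range.mp hm)), map_add,
      PowerSeries.coeff_C_mul, shiftSeries]
  rw [taylorSeries_sum _ fun m _ => hterm m, map_sum, Finset.sum_congr rfl hcoeff,
    Finset.sum_range_succ'] at hz
  have h0 : (fun s => (sinPowOsc 0 (g s θ) : ℂ)) = fun _ => 0 := by
    funext s
    simp [sinPowOsc, sinPowMean]
  simp only [Nat.add_sub_add_right] at hz
  rw [h0, taylorSeries_const, invSqrtCoeff, sinPowMean] at hz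
  simp only [map_zero, Ring.choose_zero_right, pow_zero, mul_one, Complex.ofReal_one, one_mul,
    Finset.range_zero, Finset.prod_empty, zero_add, Nat.sub_zero] at hz
  exact eq_neg_of_add_eq_zero_right hz

lemma hasLowestMode_coeff (hε0 : 0 < ε) (hε1 : ε < 1) (hg0 : ∀ θ, g 0 θ = θ)
    (hg : ∀ θ, ContDiffAt ℝ ∞ (fun s => g s θ) 0)
    (hinv : ∀ θ s : ℝ, |s| < ε → actionAngle s (g s θ) = θ) (n : ℕ) :
    HasLowestMode n (fun θ => PowerSeries.coeff n (shiftSeries g θ))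
      (Complex.I / (n * 16 ^ n)) ∧
    ∀ l : ℤ, HasLowestMode n (fun θ => PowerSeries.coeff n (expSeries g l θ)) (leadCoeff l n) := by
  induction n using Nat.strong_induction_on with
  | _ n ih =>
  rcases n with _ | n
  · constructor
    · simpa [coeff_zero_shiftSeries (hg0 _)] using HasLowestMode.zero 0
    · intro l
      have h := HasLowestMode.expMode_nat_sub 0 0
      simp only [Nat.cast_zero, sub_zero, funext expMode_zero, if_pos] at h
      simpa [coeff_zero_expSeries (hg0 _), leadCoeff] using h
  · have hshift : HasLowestMode (n + 1) (fun θ => PowerSeries.coeff (n + 1) (shiftSeries g θ))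
        (Complex.I / ((n + 1 : ℕ) * 16 ^ (n + 1))) := by
      have h : HasLowestMode (n + 1) _ _ := (HasLowestMode.sum (Finset.range (n + 1))
        fun m hm => by
          have hm' : n - m < n + 1 := by omega
          have hmn : m + 1 + (n - m) = n + 1 := by
            have := Finset.mem_range.mp hm
            omega
          exact (((hmn ▸ (hasLowestMode_sinPowOsc (m + 1)).coeff_comp hg (ih (n - m) hm').2).add
            (((ih (n - m) hm').1.const_mul (sinPowMean (m + 1))).of_lt
              (show n - m < n + 1 by omega))).const_mul
                (invSqrtCoeff (m + 1) : ℂ))).const_mul (-1)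
      convert h using 1
      · funext θ
        rw [coeff_shiftSeries hε0 hε1 (hg θ) (hinv θ), neg_one_mul]
      · push_cast
        rw [← neg_sum_leadCoeff_eq n, neg_one_mul]
        push_cast
        simp only [add_zero]
    refine ⟨hshift, fun l => ?_⟩
    have h : HasLowestMode (n + 1) _ _ := (HasLowestMode.sum (Finset.range (n + 1))
      fun b hb => by
        have hb' := Finset.mem_range.mp hb
        have hbn : n - b + 1 + b = n + 1 := by omega
        have hD : HasLowestMode (n - b + 1)
            (fun θ => PowerSeries.coeff (n - b + 1) (shiftSeries g θ))
            (Complex.I / ((n - b + 1 : ℕ) * 16 ^ (n - b + 1))) := by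
          rcases Nat.eq_zero_or_pos b with rfl | hb0
          · exact hshift
          · exact (ih (n - b + 1) (by omega)).1
        exact hbn ▸ ((hD.const_mul (n - b + 1 : ℕ)).mul ((ih b hb').2 l))).const_mul
          (l * Complex.I / (n + 1))
    convert h using 1
    · funext θ
      rw [coeff_succ_expSeries (hg θ)]
    · have hn : ((n : ℂ) + 1) ≠ 0 := by exact_mod_cast n.succ_ne_zero
      rw [div_mul_eq_mul_div, eq_div_iff hn, mul_comm, succ_mul_leadCoeff_succ, Finset.mul_sum,
        Finset.mul_sum]
      refine Finset.sum_congr rfl fun b _ => ?_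
      have hb : ((n - b + 1 : ℕ) : ℂ) ≠ 0 := by exact_mod_cast (n - b).succ_ne_zero
      field_simp
      linear_combination (-(l : ℂ) * leadCoeff l b) * Complex.I_sq

end AmplitudeExpansion

lemma iteratedDeriv_clm_comp {E F : Type*} [NormedAddCommGroup E] [NormedSpace ℝ E]
    [NormedAddCommGroup F] [NormedSpace ℝ F] (L : E →L[ℝ] F) {f : ℝ → E} {x : ℝ} {n : ℕ}
    (hf : ContDiffAt ℝ n f x) :
    iteratedDeriv n (fun s => L (f s)) x = L (iteratedDeriv n f x) := by
  simp only [iteratedDeriv_eq_iteratedFDeriv]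
  exact congrArg (fun q => q fun _ => (1 : ℝ)) (L.iteratedFDeriv_comp_left hf le_rfl)

lemma iteratedDeriv_exp_comp {g : ℝ → ℝ → ℝ} {θ : ℝ} (hg : ContDiffAt ℝ ∞ (fun s => g s θ) 0)
    (k j : ℕ) :
    iteratedDeriv j (fun s => Complex.exp ((k * g s θ : ℝ) * Complex.I)) 0 =
      j.factorial * (Complex.exp ((k * θ : ℝ) * Complex.I) *
        PowerSeries.coeff j (expSeries g k θ)) := by
  have h : (fun s => Complex.exp ((k * g s θ : ℝ) * Complex.I)) = fun s =>
      Complex.exp ((k * θ : ℝ) * Complex.I) *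
        Complex.exp ((k : ℤ) * Complex.I * (g s θ - θ)) := by
    funext s
    rw [← Complex.exp_add]
    congr 1
    push_cast
    ring
  rw [expSeries, ← PowerSeries.coeff_C_mul, ← taylorSeries_const_mul (contDiffAt_exp_shift hg k),
    ← h, coeff_taylorSeries, mul_div_cancel₀]
  exact_mod_cast j.factorial_ne_zero

lemma contDiffAt_exp_comp {g : ℝ → ℝ → ℝ} {θ : ℝ} (hg : ContDiffAt ℝ ∞ (fun s => g s θ) 0)
    (k : ℕ) : ContDiffAt ℝ ∞ (fun s => Complex.exp ((k * g s θ : ℝ) * Complex.I)) 0 :=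
  ((Complex.ofRealCLM.contDiff.contDiffAt.comp 0 (contDiffAt_const.mul hg)).mul
    contDiffAt_const).cexp

lemma iteratedDeriv_cos_comp {g : ℝ → ℝ → ℝ} {θ : ℝ} (hg : ContDiffAt ℝ ∞ (fun s => g s θ) 0)
    (k j : ℕ) :
    iteratedDeriv j (fun s => Real.cos (k * g s θ)) 0 =
      j.factorial * (Complex.exp ((k * θ : ℝ) * Complex.I) *
        PowerSeries.coeff j (expSeries g k θ)).re := by
  have h := iteratedDeriv_clm_comp Complex.reCLM ((contDiffAt_exp_comp hg k).of_infty j)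
  simp only [Complex.reCLM_apply, Complex.exp_ofReal_mul_I_re] at h
  rw [h, iteratedDeriv_exp_comp hg, ← Complex.ofReal_natCast, Complex.re_ofReal_mul]

lemma iteratedDeriv_sin_comp {g : ℝ → ℝ → ℝ} {θ : ℝ} (hg : ContDiffAt ℝ ∞ (fun s => g s θ) 0)
    (k j : ℕ) :
    iteratedDeriv j (fun s => Real.sin (k * g s θ)) 0 =
      j.factorial * (Complex.exp ((k * θ : ℝ) * Complex.I) *
        PowerSeries.coeff j (expSeries g k θ)).im := by
  have h := iteratedDeriv_clm_comp Complex.imCLM ((contDiffAt_exp_comp hg k).of_infty j)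
  simp only [Complex.imCLM_apply, Complex.exp_ofReal_mul_I_im] at h
  rw [h, iteratedDeriv_exp_comp hg, ← Complex.ofReal_natCast, Complex.im_ofReal_mul]

lemma re_mul_cos_add_im_mul_sin (z : ℂ) (a b θ : ℝ) (j : ℕ) (hab : a - b = 2 * j) :
    (Complex.exp ((a * θ : ℝ) * Complex.I) * z).re * Real.cos (b * θ) +
      (Complex.exp ((a * θ : ℝ) * Complex.I) * z).im * Real.sin (b * θ) =
      (expMode j θ * z).re := by
  have h : expMode j θ =
      Complex.exp ((a * θ : ℝ) * Complex.I) * Complex.exp ((-(b * θ) : ℝ) * Complex.I) := by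
    rw [expMode, ← Complex.exp_add]
    congr 1
    have hab' : (a : ℂ) - b = 2 * j := by exact_mod_cast hab
    push_cast
    rw [← hab']
    ring
  rw [h, mul_right_comm, Complex.mul_re _ (Complex.exp _), Complex.exp_ofReal_mul_I_re,
    Complex.exp_ofReal_mul_I_im, Real.cos_neg, Real.sin_neg]
  ring

theorem xi_antidiag (ε : ℝ) (hε0 : 0 < ε) (hε1 : ε < 1) (g : ℝ → ℝ → ℝ)
    (hg0 : ∀ θ : ℝ, g 0 θ = θ)
    (hsmooth : ∀ θ : ℝ, ContDiffOn ℝ ∞ (fun s => g s θ) (Set.Ioo (-ε) ε))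
    (hinv : ∀ θ : ℝ, ∀ s : ℝ, |s| < ε → actionAngle s (g s θ) = θ)
    (j k : ℕ) (hj : 1 ≤ j) (hk : 1 ≤ k) :
    (1 / (2 * π * (Nat.factorial j : ℝ))) *
      ((∫ θ in (-π)..π,
          iteratedDeriv j (fun s => Real.cos (k * g s θ)) 0
            * Real.cos (((k : ℝ) - 2 * j) * θ)) +
        (∫ θ in (-π)..π,
          iteratedDeriv j (fun s => Real.sin (k * g s θ)) 0
            * Real.sin (((k : ℝ) - 2 * j) * θ)))
      = (-1 : ℝ) ^ j * ((2:ℝ) ^ (4 * j))⁻¹ * (Nat.choose k j : ℝ) := by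
  have hg : ∀ θ, ContDiffAt ℝ ∞ (fun s => g s θ) 0 := fun θ =>
    (hsmooth θ).contDiffAt (Ioo_mem_nhds (by linarith) hε0)
  have hu := (hasLowestMode_coeff hε0 hε1 hg0 hg hinv j).2 k
  have huc := hu.continuous
  simp only [iteratedDeriv_cos_comp (hg _), iteratedDeriv_sin_comp (hg _)]
  rw [← intervalIntegral.integral_add
    (Continuous.intervalIntegrable (by fun_prop) _ _)
    (Continuous.intervalIntegrable (by fun_prop) _ _)]
  simp only [mul_assoc (j.factorial : ℝ), ← mul_add]
  have hcomb := fun θ => re_mul_cos_add_im_mul_sin (PowerSeries.coeff j (expSeries g k θ))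
    k (k - 2 * j) θ j (by ring)
  have hre := intervalIntegral.intervalIntegral_re (𝕜 := ℂ) (μ := volume) (a := -π) (b := π)
    (((continuous_expMode j).mul huc).intervalIntegrable _ _)
  simp only [Pi.mul_apply, RCLike.re_to_complex, hu.integral, Int.cast_natCast,
    leadCoeff_natCast] at hre
  have hval : (2 * (π : ℂ) * ((-1) ^ j * ((2 : ℂ) ^ (4 * j))⁻¹ * (k.choose j : ℂ))).re =
      2 * π * ((-1) ^ j * ((2 : ℝ) ^ (4 * j))⁻¹ * (k.choose j : ℝ)) := by
    rw [← Complex.ofReal_re (2 * π * _)]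
    push_cast
    rfl
  rw [intervalIntegral.integral_const_mul]
  simp only [hcomb]
  rw [hre, hval]
  have hfac : (j.factorial : ℝ) ≠ 0 := by exact_mod_cast j.factorial_ne_zero
  field_simp
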